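/- For every prime power q and integer n ≥ 1, the complexity of the vector space analog of the hypercube satisfies c(C_{F_q}(n)) = [1]_q·[2]_q⋯[n]_q · ∏_{k=1}^{⌊n/2⌋} F_q(n,k,k)^{ [n choose k]_q − [n choose k−1]_q }. -/

import Mathlib

/-- The vector space analog `C_{F_q}(n)` of the hypercube: vertices are the subspaces of
`F^n`, with `X, Y` adjacent iff one contains the other and their dimensions differ by 1. -/
def vsCube (F : Type) [Field F] (n : ℕ) : SimpleGraph (Submodule F (Fin n → F)) :=
  SimpleGraph.fromRel
    (fun X Y => X ≤ Y ∧ Module.finrank F Y = Module.finrank F X + 1)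

/-- The number of spanning trees of a graph. -/
noncomputable def complexity {V : Type*} (G : SimpleGraph V) : ℕ :=
  Set.ncard {t : Finset (Sym2 V) |
    (t : Set (Sym2 V)) ⊆ G.edgeSet ∧ (SimpleGraph.fromEdgeSet (t : Set (Sym2 V))).IsTree}

/-- The `q`-integer `[m]_q = 1 + q + ⋯ + q^{m-1}`. -/
def qInt (q m : ℕ) : ℕ := ∑ i ∈ Finset.range m, q ^ i

/-- The Gaussian binomial coefficient `[n choose k]_q`: the number of `k`-dimensional
subspaces of `F^n` (where `q = |F|`). -/
noncomputable def gauss (F : Type) [Field F] (n k : ℕ) : ℕ :=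
  Nat.card {X : Submodule F (Fin n → F) // Module.finrank F X = k}

/-- Auxiliary descending recursion: `Faux n k d = F_q(n, k, n-k+1-d)`. -/
noncomputable def Faux (n k : ℕ) : ℕ → Polynomial ℤ
  | 0 => 1
  | 1 => (∑ i ∈ Finset.range k, Polynomial.X ^ i) + ∑ i ∈ Finset.range (n - k), Polynomial.X ^ i
  | (d + 2) =>
      ((∑ i ∈ Finset.range (n - k - 1 - d), Polynomial.X ^ i) +
          ∑ i ∈ Finset.range (n - (n - k - 1 - d)), Polynomial.X ^ i) * Faux n k (d + 1) -
        Polynomial.X ^ k * (∑ i ∈ Finset.range ((n - k - 1 - d) + 1 - k), Polynomial.X ^ i) *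
          (∑ i ∈ Finset.range (n - k - (n - k - 1 - d)), Polynomial.X ^ i) * Faux n k d

/-- The polynomial `F_q(n, k, j)` of the paper, defined for `k ≤ j ≤ n-k+1` by:
`F_q(n,k,n-k+1) = 1`, `F_q(n,k,n-k) = [k]_q + [n-k]_q`, and for `k ≤ j < n-k`,
`F_q(n,k,j) = ([j]_q + [n-j]_q)·F_q(n,k,j+1) - q^k·[j+1-k]_q·[n-k-j]_q·F_q(n,k,j+2)`. -/
noncomputable def FP (n k j : ℕ) : Polynomial ℤ :=
  Faux n k (n - k + 1 - j)

open Finset Polynomial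

namespace Matrix

/-- Two block triangular matrices with the same diagonal blocks have the same determinant. -/
theorem BlockTriangular.det_eq_of_eq_on_blocks {V R α : Type*} [Fintype V] [DecidableEq V]
    [CommRing R] [LinearOrder α] {b : V → α} {A A' : Matrix V V R}
    (hA : A.BlockTriangular b) (hA' : A'.BlockTriangular b)
    (h : ∀ i j, b i = b j → A i j = A' i j) : A.det = A'.det := by
  rw [hA.det, hA'.det]
  refine prod_congr rfl fun k _ => congrArg det ?_
  ext i j
  exact h _ _ (i.2.trans j.2.symm)

end Matrix

section MatrixTree

theorem edgeSet_fromEdgeSet_of_subset {V : Type*} {G : SimpleGraph V} {t : Finset (Sym2 V)}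
    (ht : (t : Set (Sym2 V)) ⊆ G.edgeSet) :
    (SimpleGraph.fromEdgeSet (t : Set (Sym2 V))).edgeSet = t := by
  rw [SimpleGraph.edgeSet_fromEdgeSet, sdiff_eq_left, Set.disjoint_left]
  intro e he
  exact G.not_isDiag_of_mem_edgeSet (ht he)

theorem exists_adj_dist_add_one {V : Type*} {T : SimpleGraph V} (hT : T.Connected) {v r : V}
    (hv : v ≠ r) :
    ∃ u, T.Adj v u ∧ T.dist u r + 1 = T.dist v r := by
  obtain ⟨p, hp⟩ := (hT v r).exists_walk_length_eq_dist
  cases p with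
  | nil => exact absurd rfl hv
  | @cons _ u _ hadj p =>
    refine ⟨u, hadj, ?_⟩
    have h1 := SimpleGraph.dist_le p
    have h2 : T.dist v r ≤ T.dist v u + T.dist u r := hT.dist_triangle
    rw [SimpleGraph.dist_eq_one_iff_adj.mpr hadj] at h2
    rw [SimpleGraph.Walk.length_cons] at hp
    omega

variable {V : Type*} [Fintype V] [DecidableEq V]

/-- The parent maps of the spanning trees of `G` rooted at `r`: maps fixing `r`, moving every other
vertex along an edge, and eventually sending every vertex to `r`. -/
def parentMaps (G : SimpleGraph V) (r : V) : Set (V → V) :=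
  {φ | φ r = r ∧ (∀ v, v ≠ r → G.Adj v (φ v)) ∧ ∀ v, ∃ k, φ^[k] v = r}

/-- The edges joining each vertex other than `r` to its parent. -/
def parentEdges (r : V) (φ : V → V) : Finset (Sym2 V) :=
  (univ.erase r).image fun v => s(v, φ v)

theorem mem_parentEdges {r : V} {φ : V → V} {e : Sym2 V} :
    e ∈ parentEdges r φ ↔ ∃ v, v ≠ r ∧ s(v, φ v) = e := by
  simp [parentEdges]

theorem card_parentEdges_add_one_le (r : V) (φ : V → V) :
    (parentEdges r φ).card + 1 ≤ Fintype.card V := by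
  have h := card_image_le (s := univ.erase r) (f := fun v => s(v, φ v))
  rw [card_erase_of_mem (mem_univ r), card_univ] at h
  have := Fintype.card_pos_iff.mpr ⟨r⟩
  unfold parentEdges
  omega

theorem parentEdges_subset {G : SimpleGraph V} {r : V} {φ : V → V} (hφ : φ ∈ parentMaps G r) :
    (parentEdges r φ : Set (Sym2 V)) ⊆ G.edgeSet := by
  intro e he
  obtain ⟨v, hv, rfl⟩ := mem_parentEdges.mp he
  exact hφ.2.1 v hv

theorem isTree_parentEdges {G : SimpleGraph V} {r : V} {φ : V → V} (hφ : φ ∈ parentMaps G r) :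
    (SimpleGraph.fromEdgeSet (parentEdges r φ : Set (Sym2 V))).IsTree := by
  set T := SimpleGraph.fromEdgeSet (parentEdges r φ : Set (Sym2 V)) with hT
  have hstep : ∀ v, T.Reachable v (φ v) := by
    intro v
    by_cases hv : v = r
    · rw [hv, hφ.1]
    · refine SimpleGraph.Adj.reachable ?_
      rw [hT, SimpleGraph.fromEdgeSet_adj]
      exact ⟨mem_parentEdges.mpr ⟨v, hv, rfl⟩, (hφ.2.1 v hv).ne⟩
  have hroot : ∀ v, T.Reachable v r := by
    intro v
    obtain ⟨k, hk⟩ := hφ.2.2 v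
    rw [← hk]
    clear hk
    induction k with
    | zero => exact SimpleGraph.Reachable.refl _
    | succ k ih =>
      rw [Function.iterate_succ_apply']
      exact ih.trans (hstep _)
  have hconn : T.Connected :=
    { preconnected := fun u v => (hroot u).trans (hroot v).symm
      nonempty := ⟨r⟩ }
  refine SimpleGraph.isTree_iff_connected_and_card.mpr ⟨hconn, ?_⟩
  have h1 := hconn.card_vert_le_card_edgeSet_add_one
  have h2 := card_parentEdges_add_one_le r φ
  have h3 : Nat.card T.edgeSet = (parentEdges r φ).card := by
    rw [hT, edgeSet_fromEdgeSet_of_subset (parentEdges_subset hφ)]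
    simp
  rw [Nat.card_eq_fintype_card (α := V)] at *
  omega

theorem parentEdges_injOn (G : SimpleGraph V) (r : V) :
    Set.InjOn (parentEdges r) (parentMaps G r) := by
  intro φ hφ ψ hψ h
  have hback : ∀ x, x ≠ r → φ x ≠ ψ x → ψ x ≠ r ∧ φ (ψ x) = x := by
    intro x hx hne
    have hmem : s(x, ψ x) ∈ parentEdges r φ := h ▸ mem_parentEdges.mpr ⟨x, hx, rfl⟩
    obtain ⟨z, hz, hzx⟩ := mem_parentEdges.mp hmem
    rcases Sym2.eq_iff.mp hzx with ⟨rfl, h2⟩ | ⟨rfl, h2⟩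
    · exact absurd h2 hne
    · exact ⟨hz, h2⟩
  funext v
  by_contra hne
  have hv : v ≠ r := by
    rintro rfl
    exact hne (hφ.1.trans hψ.1.symm)
  have hall : ∀ k, ψ^[k] v ≠ r ∧ φ (ψ^[k] v) ≠ ψ (ψ^[k] v) := by
    intro k
    induction k with
    | zero => exact ⟨hv, hne⟩
    | succ k ih =>
      rw [Function.iterate_succ_apply']
      set x := ψ^[k] v
      obtain ⟨hy, hyx⟩ := hback x ih.1 ih.2
      refine ⟨hy, fun hcyc => ?_⟩
      have hcyc' : ψ (ψ x) = x := hcyc.symm.trans hyx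
      obtain ⟨m, hm⟩ := hψ.2.2 x
      have hor : ∀ m, ψ^[m] x = x ∨ ψ^[m] x = ψ x := by
        intro m
        induction m with
        | zero => exact Or.inl rfl
        | succ m ihm =>
          rw [Function.iterate_succ_apply']
          rcases ihm with e | e <;> rw [e]
          · exact Or.inr rfl
          · exact Or.inl hcyc'
      rcases hor m with e | e
      · exact ih.1 (e.symm.trans hm)
      · exact hy (e.symm.trans hm)
  obtain ⟨k, hk⟩ := hψ.2.2 v
  exact (hall k).1 hk

theorem exists_parentMap {G : SimpleGraph V} (r : V) {t : Finset (Sym2 V)}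
    (ht : (t : Set (Sym2 V)) ⊆ G.edgeSet)
    (hT : (SimpleGraph.fromEdgeSet (t : Set (Sym2 V))).IsTree) :
    ∃ φ ∈ parentMaps G r, parentEdges r φ = t := by
  set T := SimpleGraph.fromEdgeSet (t : Set (Sym2 V)) with hTdef
  have hconn : T.Connected := hT.1
  choose! f hf using fun (v : V) (hv : v ≠ r) => exists_adj_dist_add_one hconn hv
  set φ : V → V := fun v => if v = r then r else f v with hφdef
  have hφr : φ r = r := if_pos rfl
  have hφv : ∀ v, v ≠ r → φ v = f v := fun v hv => if_neg hv
  have hmem : ∀ v, v ≠ r → s(v, φ v) ∈ t := by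
    intro v hv
    have := (hf v hv).1
    rw [hTdef, SimpleGraph.fromEdgeSet_adj] at this
    rw [hφv v hv]
    exact this.1
  have hφ : φ ∈ parentMaps G r := by
    refine ⟨hφr, fun v hv => ht (hmem v hv), fun v => ?_⟩
    induction hd : T.dist v r using Nat.strong_induction_on generalizing v with
    | _ d ih =>
      by_cases hv : v = r
      · exact ⟨0, hv⟩
      · have h2 := (hf v hv).2
        rw [← hφv v hv] at h2
        obtain ⟨k, hk⟩ := ih (T.dist (φ v) r) (by omega) (φ v) rfl
        exact ⟨k + 1, hk⟩
  refine ⟨φ, hφ, eq_of_subset_of_card_le ?_ ?_⟩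
  · intro e he
    obtain ⟨v, hv, rfl⟩ := mem_parentEdges.mp he
    exact hmem v hv
  · have h1 := (SimpleGraph.isTree_iff_connected_and_card.mp hT).2
    have h2 := (SimpleGraph.isTree_iff_connected_and_card.mp (isTree_parentEdges hφ)).2
    rw [edgeSet_fromEdgeSet_of_subset (parentEdges_subset hφ)] at h2
    rw [hTdef, edgeSet_fromEdgeSet_of_subset ht] at h1
    simp only [SetLike.coe_sort_coe, Nat.card_eq_fintype_card, Fintype.card_coe] at h1 h2
    omega

theorem complexity_eq_ncard_parentMaps (G : SimpleGraph V) (r : V) :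
    complexity G = (parentMaps G r).ncard := by
  rw [complexity, ← (parentEdges_injOn G r).ncard_image]
  congr 1
  ext t
  constructor
  · rintro ⟨h1, h2⟩
    exact exists_parentMap r h1 h2
  · rintro ⟨φ, hφ, rfl⟩
    exact ⟨parentEdges_subset hφ, isTree_parentEdges hφ⟩

/-- The row of the matrix `1 - Φ` of a parent map, where the row of the root is a unit vector. -/
def parentRow (r v u : V) : V → ℚ :=
  if v = r then Pi.single v 1 else Pi.single v 1 - Pi.single u 1

theorem det_parentRow_eq_one {r : V} {φ : V → V} (hφ : ∀ v, ∃ k, φ^[k] v = r) :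
    (Matrix.of fun v => parentRow r v (φ v)).det = 1 := by
  set h : V → ℕ := fun v => Nat.find (hφ v) with hh
  have hdec : ∀ v, v ≠ r → h (φ v) < h v := by
    intro v hv
    have hspec : φ^[h v] v = r := Nat.find_spec (hφ v)
    obtain ⟨m, hm⟩ : ∃ m, h v = m + 1 :=
      Nat.exists_eq_succ_of_ne_zero fun h0 => hv (by rw [h0] at hspec; exact hspec)
    rw [hm, Function.iterate_succ_apply] at hspec
    have : h (φ v) ≤ m := Nat.find_le hspec
    omega
  have hentry : ∀ v u, h v ≤ h u →
      (Matrix.of fun v => parentRow r v (φ v)) v u = (1 : Matrix V V ℚ) v u := by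
    intro v u huv
    rw [Matrix.of_apply, parentRow]
    split_ifs with hv
    · simp [Pi.single_apply, Matrix.one_apply, eq_comm]
    · have : u ≠ φ v := by
        rintro rfl
        exact absurd (hdec v hv) (not_lt.mpr huv)
      simp [Pi.single_apply, Matrix.one_apply, this, eq_comm]
  rw [← Matrix.det_one (n := V) (R := ℚ)]
  refine Matrix.BlockTriangular.det_eq_of_eq_on_blocks (b := OrderDual.toDual ∘ h) ?_
    Matrix.blockTriangular_one fun i j hij => hentry i j (le_of_eq (OrderDual.toDual_inj.mp hij))
  intro i j hij
  have hij' : h i < h j := hij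
  rw [hentry i j hij'.le, Matrix.one_apply_ne (by rintro rfl; exact lt_irrefl _ hij')]

theorem det_parentRow_eq_zero {r : V} {φ : V → V} (hr : φ r = r)
    (hφ : ¬ ∀ v, ∃ k, φ^[k] v = r) :
    (Matrix.of fun v => parentRow r v (φ v)).det = 0 := by
  classical
  refine Matrix.exists_mulVec_eq_zero_iff.mp
    ⟨fun v => if ∃ k, φ^[k] v = r then 0 else 1, fun h0 => hφ fun v => ?_, ?_⟩
  · by_contra hv
    have := congrFun h0 v
    simp only [if_neg hv] at this
    exact one_ne_zero this
  · have hiff : ∀ v, (∃ k, φ^[k] (φ v) = r) ↔ ∃ k, φ^[k] v = r := by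
      refine fun v => ⟨fun ⟨k, hk⟩ => ⟨k + 1, hk⟩, fun ⟨k, hk⟩ => ⟨k, ?_⟩⟩
      rw [← Function.iterate_succ_apply, Function.iterate_succ_apply', hk, hr]
    funext v
    rw [Matrix.mulVec, Pi.zero_apply]
    change parentRow r v (φ v) ⬝ᵥ _ = 0
    rw [parentRow]
    split_ifs with hv
    · rw [single_dotProduct, if_pos ⟨0, hv⟩, mul_zero]
    · rw [sub_dotProduct, single_dotProduct, single_dotProduct]
      simp only [hiff, sub_self]

/-- The matrix-tree theorem: the number of spanning trees is the determinant of the Laplacian with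
the diagonal entry of one vertex increased by one. -/
theorem complexity_eq_det (G : SimpleGraph V) [DecidableRel G.Adj] (r : V) :
    (complexity G : ℚ) = (G.lapMatrix ℚ + Matrix.single r r 1).det := by
  classical
  have hdet0 : (G.lapMatrix ℚ).det = 0 :=
    Matrix.exists_mulVec_eq_zero_iff.mp ⟨fun _ => 1, fun h => one_ne_zero (congrFun h r),
      G.lapMatrix_mulVec_const_eq_zero⟩
  have hupd : G.lapMatrix ℚ + Matrix.single r r 1
      = (G.lapMatrix ℚ).updateRow r (G.lapMatrix ℚ r + Pi.single r 1) := by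
    ext i j
    by_cases hi : i = r
    · subst hi
      simp [Matrix.updateRow_self, Matrix.single_apply, Pi.single_apply, eq_comm]
    · simp [Matrix.updateRow_ne hi, Ne.symm hi]
  set S : V → Finset V := fun v => if v = r then {r} else G.neighborFinset v with hS
  have hrow : (G.lapMatrix ℚ).updateRow r (Pi.single r 1)
      = Matrix.of fun v => ∑ u ∈ S v, parentRow r v u := by
    ext v w
    by_cases hv : v = r
    · subst hv
      simp [hS, parentRow, Matrix.updateRow_self]
    · rw [Matrix.updateRow_ne hv, Matrix.of_apply, Finset.sum_apply]
      simp only [hS, if_neg hv, parentRow, Pi.sub_apply, sum_sub_distrib, sum_const,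
        SimpleGraph.card_neighborFinset_eq_degree, SimpleGraph.lapMatrix, Matrix.sub_apply,
        SimpleGraph.degMatrix, SimpleGraph.adjMatrix_apply]
      congr 1
      · simp [Matrix.diagonal_apply, Pi.single_apply, eq_comm]
      · simp [Pi.single_apply]
  have hmulti : (Matrix.of fun v => ∑ u ∈ S v, parentRow r v u).det
      = ∑ φ ∈ Fintype.piFinset S, (Matrix.of fun v => parentRow r v (φ v)).det :=
    (Matrix.detRowAlternating (n := V) (R := ℚ)).toMultilinearMap.map_sum_finset
      (fun v u => parentRow r v u) S
  have hmem : ∀ φ, φ ∈ Fintype.piFinset S ↔ φ r = r ∧ ∀ v, v ≠ r → G.Adj v (φ v) := by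
    intro φ
    rw [Fintype.mem_piFinset]
    constructor
    · intro h
      refine ⟨by simpa [hS] using h r, fun v hv => by simpa [hS, hv] using h v⟩
    · rintro ⟨h1, h2⟩ v
      by_cases hv : v = r
      · simp [hS, hv, h1]
      · simpa [hS, hv] using h2 v hv
  have hset : parentMaps G r
      = ((Fintype.piFinset S).filter fun φ => ∀ v, ∃ k, φ^[k] v = r : Finset (V → V)) := by
    ext φ
    rw [coe_filter, Set.mem_ofPred_eq, hmem, and_assoc]
    rfl
  rw [hupd, Matrix.det_updateRow_add, Matrix.updateRow_eq_self, hdet0, zero_add, hrow, hmulti,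
    complexity_eq_ncard_parentMaps G r, hset, Set.ncard_coe_finset, card_filter, Nat.cast_sum]
  refine sum_congr rfl fun φ hφ => ?_
  split_ifs with h
  · rw [det_parentRow_eq_one h, Nat.cast_one]
  · rw [det_parentRow_eq_zero ((hmem φ).mp hφ).1 h, Nat.cast_zero]

end MatrixTree

section GradedDeterminant

theorem level_eq_of_mul_apply_ne_zero {V : Type*} [Fintype V] {d : V → ℕ}
    {U D : Matrix V V ℚ} (hU : ∀ x y, U x y ≠ 0 → d x = d y + 1)
    (hD : ∀ x y, D x y ≠ 0 → d y = d x + 1) (x y : V) (h : (U * D) x y ≠ 0) : d x = d y := by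
  rw [Matrix.mul_apply] at h
  obtain ⟨z, -, hz⟩ := exists_ne_zero_of_sum_ne_zero h
  rw [hU x z (left_ne_zero_of_mul hz), hD z y (right_ne_zero_of_mul hz)]

variable {V : Type*} [Fintype V] [DecidableEq V]

theorem mul_aeval_eq_aeval_mul {A M M' : Matrix V V ℚ} (h : A * M = M' * A) (p : ℚ[X]) :
    A * aeval M p = aeval M' p * A := by
  induction p using Polynomial.induction_on' with
  | add p q hp hq => rw [map_add, map_add, mul_add, add_mul, hp, hq]
  | monomial k r =>
    have hk : A * M ^ k = M' ^ k * A := (show SemiconjBy A M M' from h).pow_right k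
    rw [aeval_monomial, aeval_monomial, ← mul_assoc, ← Algebra.commutes r A, mul_assoc, hk,
      mul_assoc]

/-- Evaluate at `W` a polynomial depending on the level `d x` of the row `x`. -/
noncomputable def levelEval (d : V → ℕ) (W : Matrix V V ℚ) (p : ℕ → ℚ[X]) : Matrix V V ℚ :=
  Matrix.of fun x y => aeval W (p (d x)) x y

/-- The family obtained from `p` by moving it across an operator lowering the level by one. -/
noncomputable def levelShift (c : ℕ → ℚ) (p : ℕ → ℚ[X]) : ℕ → ℚ[X] :=
  fun j => (p (j + 1)).comp (X + C (c j))

variable {d : V → ℕ} {W : Matrix V V ℚ}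

theorem levelEval_congr {p r : ℕ → ℚ[X]} (h : ∀ x, p (d x) = r (d x)) :
    levelEval d W p = levelEval d W r := by
  ext x y
  simp only [levelEval, Matrix.of_apply, h]

theorem levelEval_add (p r : ℕ → ℚ[X]) :
    levelEval d W (p + r) = levelEval d W p + levelEval d W r := by
  ext x y
  simp [levelEval]

theorem levelEval_C (f : ℕ → ℚ) :
    levelEval d W (fun j => C (f j)) = Matrix.diagonal fun x => f (d x) := by
  ext x y
  simp [levelEval, Matrix.algebraMap_matrix_apply, Matrix.diagonal_apply]

theorem levelEval_one : levelEval d W 1 = 1 := by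
  ext x y
  simp [levelEval]

theorem levelEval_X : levelEval d W (fun _ => X) = W := by
  ext x y
  simp [levelEval]

theorem diagonal_mul_eq_mul_diagonal {A : Matrix V V ℚ} {f g : V → ℚ}
    (h : ∀ x y, A x y ≠ 0 → f x = g y) :
    Matrix.diagonal f * A = A * Matrix.diagonal g := by
  ext x y
  rw [Matrix.diagonal_mul, Matrix.mul_diagonal]
  by_cases hxy : A x y = 0
  · rw [hxy, mul_zero, zero_mul]
  · rw [h x y hxy, mul_comm]

theorem aeval_apply_eq_zero (hW : ∀ x y, W x y ≠ 0 → d x = d y) (p : ℚ[X]) {x y : V}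
    (hxy : d x ≠ d y) : aeval W p x y = 0 := by
  have h := mul_aeval_eq_aeval_mul
    (diagonal_mul_eq_mul_diagonal (f := fun x => (d x : ℚ)) (g := fun x => (d x : ℚ))
      fun x y h => congrArg _ (hW x y h)) p
  have h' := congrFun (congrFun h x) y
  rw [Matrix.diagonal_mul, Matrix.mul_diagonal, mul_comm, ← sub_eq_zero, ← mul_sub] at h'
  refine (mul_eq_zero.mp h').resolve_right fun h0 => hxy ?_
  exact_mod_cast sub_eq_zero.mp h0

theorem levelEval_mul (hW : ∀ x y, W x y ≠ 0 → d x = d y) (p r : ℕ → ℚ[X]) :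
    levelEval d W (p * r) = levelEval d W p * levelEval d W r := by
  ext x y
  rw [levelEval, Matrix.of_apply, Pi.mul_apply, map_mul, Matrix.mul_apply, Matrix.mul_apply]
  refine sum_congr rfl fun z _ => ?_
  rw [levelEval, levelEval, Matrix.of_apply, Matrix.of_apply]
  by_cases hxz : d x = d z
  · rw [hxz]
  · rw [aeval_apply_eq_zero hW _ hxz, zero_mul, zero_mul]

theorem levelEval_apply_eq_zero (hW : ∀ x y, W x y ≠ 0 → d x = d y) (p : ℕ → ℚ[X]) {x y : V}
    (hxy : d x ≠ d y) : levelEval d W p x y = 0 :=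
  aeval_apply_eq_zero hW _ hxy

theorem aeval_add_diagonal_apply (hW : ∀ x y, W x y ≠ 0 → d x = d y) (c : ℕ → ℚ) (p : ℚ[X])
    (x y : V) :
    aeval (W + Matrix.diagonal fun x => c (d x)) p x y
      = aeval W (p.comp (X + C (c (d x)))) x y := by
  set P : Matrix V V ℚ := Matrix.diagonal fun z => if d z = d x then 1 else 0 with hP
  have hPW : P * W = W * P := diagonal_mul_eq_mul_diagonal fun u v h => by rw [hW u v h]
  have hPc : P * Matrix.diagonal (fun x => c (d x)) = algebraMap ℚ (Matrix V V ℚ) (c (d x)) * P := by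
    rw [hP, Matrix.algebraMap_eq_diagonal, Matrix.diagonal_mul_diagonal,
      Matrix.diagonal_mul_diagonal]
    congr 1
    funext z
    by_cases hz : d z = d x <;> simp [hz]
  have h := mul_aeval_eq_aeval_mul (A := P) (M := W + Matrix.diagonal fun x => c (d x))
    (M' := W + algebraMap ℚ (Matrix V V ℚ) (c (d x))) (by rw [mul_add, add_mul, hPW, hPc]) p
  have h' := congrFun (congrFun h x) y
  rw [hP, Matrix.diagonal_mul, Matrix.mul_diagonal, if_pos rfl, one_mul] at h'
  have hcomp : aeval W (p.comp (X + C (c (d x))))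
      = aeval (W + algebraMap ℚ (Matrix V V ℚ) (c (d x))) p := by
    rw [aeval_comp, map_add, aeval_X, aeval_C]
  rw [h', hcomp]
  split_ifs with hy
  · rw [mul_one]
  · rw [mul_zero, ← hcomp, aeval_apply_eq_zero hW _ (Ne.symm hy)]

variable {U D : Matrix V V ℚ} {c : ℕ → ℚ}

theorem mul_levelEval (hU : ∀ x y, U x y ≠ 0 → d x = d y + 1)
    (hD : ∀ x y, D x y ≠ 0 → d y = d x + 1)
    (hc : D * U = U * D + Matrix.diagonal fun x => c (d x)) (p : ℕ → ℚ[X]) :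
    D * levelEval d (U * D) p = levelEval d (U * D) (levelShift c p) * D := by
  ext x y
  have h := congrFun (congrFun (mul_aeval_eq_aeval_mul (mul_assoc D U D).symm (p (d x + 1))) x) y
  rw [Matrix.mul_apply, Matrix.mul_apply] at h ⊢
  trans ∑ z, D x z * aeval (U * D) (p (d x + 1)) z y
  · refine sum_congr rfl fun z _ => ?_
    by_cases hz : D x z = 0
    · rw [hz, zero_mul, zero_mul]
    · rw [levelEval, Matrix.of_apply, hD x z hz]
  · rw [h, hc]
    refine sum_congr rfl fun z _ => ?_
    rw [aeval_add_diagonal_apply (level_eq_of_mul_apply_ne_zero hU hD)]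
    rfl

theorem levelEval_mul_eq_mul_levelEval (hU : ∀ x y, U x y ≠ 0 → d x = d y + 1)
    (hD : ∀ x y, D x y ≠ 0 → d y = d x + 1)
    (hc : D * U = U * D + Matrix.diagonal fun x => c (d x)) (p : ℕ → ℚ[X]) :
    levelEval d (U * D) p * U = U * levelEval d (U * D) (levelShift c p) := by
  ext x y
  have h := congrFun (congrFun (mul_aeval_eq_aeval_mul (mul_assoc U D U).symm (p (d x))) x) y
  rw [Matrix.mul_apply, Matrix.mul_apply] at h ⊢
  refine h.symm.trans (sum_congr rfl fun z _ => ?_)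
  by_cases hz : U x z = 0
  · rw [hz, zero_mul, zero_mul]
  · rw [hc, aeval_add_diagonal_apply (level_eq_of_mul_apply_ne_zero hU hD), hU x z hz]
    rfl

theorem mul_eq_levelEval (hc : D * U = U * D + Matrix.diagonal fun x => c (d x)) :
    D * U = levelEval d (U * D) (fun j => X + C (c j)) := by
  have h := levelEval_add (d := d) (W := U * D) (fun _ => X) (fun j => C (c j))
  rw [levelEval_X, levelEval_C] at h
  exact hc.trans h.symm

theorem det_levelEval_one_add (hU : ∀ x y, U x y ≠ 0 → d x = d y + 1)
    (hD : ∀ x y, D x y ≠ 0 → d y = d x + 1)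
    (hc : D * U = U * D + Matrix.diagonal fun x => c (d x)) (k : ℕ → ℚ[X]) :
    (levelEval d (U * D) (1 + k * fun _ => X)).det
      = (levelEval d (U * D) (levelShift c (1 + k * fun _ => X))).det := by
  have hW := level_eq_of_mul_apply_ne_zero hU hD
  have hshift : levelShift c (1 + k * fun _ => X)
      = 1 + levelShift c k * fun j => X + C (c j) := by
    funext j
    simp [levelShift]
  rw [hshift, levelEval_add, levelEval_add, levelEval_mul hW, levelEval_mul hW, levelEval_one,
    levelEval_X, ← mul_eq_levelEval hc, ← mul_assoc, Matrix.det_one_add_mul_comm, ← mul_assoc,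
    ← mul_assoc, mul_levelEval hU hD hc]

theorem det_levelEval_mul_prod (hU : ∀ x y, U x y ≠ 0 → d x = d y + 1)
    (hD : ∀ x y, D x y ≠ 0 → d y = d x + 1)
    (hc : D * U = U * D + Matrix.diagonal fun x => c (d x)) (p : ℕ → ℚ[X])
    (hp : ∀ j, (p j).eval 0 ≠ 0) :
    (levelEval d (U * D) p).det * ∏ x, (p (d x + 1)).eval 0
      = (∏ x, (p (d x)).eval 0) * (levelEval d (U * D) (levelShift c p)).det := by
  have hW := level_eq_of_mul_apply_ne_zero hU hD
  set k : ℕ → ℚ[X] := fun j => C ((p j).eval 0)⁻¹ * divX (p j) with hk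
  have hfac : p = (fun j => C ((p j).eval 0)) * (1 + k * fun _ => X) := by
    funext j
    have hcc : C ((p j).eval 0) * C ((p j).eval 0)⁻¹ = 1 := by
      rw [← C_mul, mul_inv_cancel₀ (hp j), C_1]
    have h := divX_mul_X_add (p j)
    rw [coeff_zero_eq_eval_zero] at h
    simp only [Pi.mul_apply, Pi.add_apply, Pi.one_apply, hk]
    linear_combination (-1 : ℚ[X]) * h - (p j).divX * X * hcc
  have hshift : levelShift c p = (fun j => C ((p (j + 1)).eval 0)) *
      levelShift c (1 + k * fun _ => X) := by
    funext j
    conv_lhs => rw [hfac]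
    simp [levelShift]
  have h1 : (levelEval d (U * D) p).det
      = (∏ x, (p (d x)).eval 0) * (levelEval d (U * D) (1 + k * fun _ => X)).det := by
    conv_lhs => rw [hfac, levelEval_mul hW, levelEval_C, Matrix.det_mul, Matrix.det_diagonal]
  rw [h1, hshift, levelEval_mul hW, levelEval_C, Matrix.det_mul, Matrix.det_diagonal,
    det_levelEval_one_add hU hD hc]
  ring

theorem det_levelEval_ne_zero (hU : ∀ x y, U x y ≠ 0 → d x = d y + 1)
    (hD : ∀ x y, D x y ≠ 0 → d y = d x + 1)
    (hc : D * U = U * D + Matrix.diagonal fun x => c (d x)) {w : ℕ → ℚ} (hw : ∀ j, 0 ≤ w j)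
    (hwc : ∀ j, w j + c j ≤ w (j + 1)) (m : ℕ) (p : ℕ → ℚ[X]) (hm : ∀ j, m ≤ j → p j = 1)
    (hp : ∀ j x, x ≤ w j → 0 < (p j).eval x) : (levelEval d (U * D) p).det ≠ 0 := by
  induction m generalizing p with
  | zero =>
    rw [show p = 1 from funext fun j => hm j (Nat.zero_le j), levelEval_one, Matrix.det_one]
    exact one_ne_zero
  | succ m ih =>
    have hp0 : ∀ j, (p j).eval 0 ≠ 0 := fun j => (hp j 0 (hw j)).ne'
    have h := det_levelEval_mul_prod hU hD hc p hp0
    refine left_ne_zero_of_mul (h ▸ mul_ne_zero (prod_ne_zero_iff.mpr fun x _ => hp0 _) ?_)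
    refine ih _ (fun j hj => ?_) fun j x hx => ?_
    · simp [levelShift, hm (j + 1) (by omega)]
    · rw [levelShift, eval_comp]
      refine hp _ _ ?_
      simp only [eval_add, eval_X, eval_C]
      linarith [hwc j]

/-- The determinant of a graded tridiagonal operator whose raising and lowering parts commute up to
a scalar on each level. -/
theorem det_diagonal_sub_sub_mul_prod (hU : ∀ x y, U x y ≠ 0 → d x = d y + 1)
    (hD : ∀ x y, D x y ≠ 0 → d y = d x + 1)
    (hc : D * U = U * D + Matrix.diagonal fun x => c (d x)) {w : ℕ → ℚ} (hw : ∀ j, 0 ≤ w j)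
    (hwc : ∀ j, w j + c j ≤ w (j + 1)) (m : ℕ) (p : ℕ → ℚ[X]) (hm : ∀ j, m ≤ j → p j = 1)
    (hp : ∀ j x, x ≤ w j → 0 < (p j).eval x) (a : ℕ → ℚ)
    (hrec : ∀ x, p (d x) = C (a (d x)) * levelShift c p (d x)
      - levelShift c (levelShift c p) (d x) * (X + C (c (d x)))) :
    (Matrix.diagonal (fun x => a (d x)) - U - D).det * ∏ x, (p (d x + 1)).eval 0
      = ∏ x, (p (d x)).eval 0 := by
  have hW := level_eq_of_mul_apply_ne_zero hU hD
  set N := levelEval d (U * D) p with hN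
  set N' := levelEval d (U * D) (levelShift c p) with hN'
  set N'' := levelEval d (U * D) (levelShift c (levelShift c p)) with hN''
  have hDN : D * N' = N'' * D := mul_levelEval hU hD hc _
  have hNU : N * U = U * N' := levelEval_mul_eq_mul_levelEval hU hD hc _
  have hsum : N + N'' * (D * U) = Matrix.diagonal (fun x => a (d x)) * N' := by
    rw [mul_eq_levelEval hc, hN'', hN', ← levelEval_C (W := U * D), ← levelEval_mul hW,
      ← levelEval_mul hW, hN, ← levelEval_add]
    refine levelEval_congr fun x => ?_
    simp only [Pi.add_apply, Pi.mul_apply, hrec x]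
    ring
  have hfac : (Matrix.diagonal (fun x => a (d x)) - U - D) * N' = (N - N'' * D) * (1 - U) := by
    rw [sub_mul, sub_mul, ← hsum, ← hNU, hDN]
    noncomm_ring
  have hdetU : (1 - U).det = 1 := by
    rw [← Matrix.det_one (n := V) (R := ℚ)]
    have hzero : ∀ x y, d x ≤ d y → U x y = 0 := fun x y hxy => by
      by_contra h
      have := hU x y h
      omega
    refine Matrix.BlockTriangular.det_eq_of_eq_on_blocks (b := OrderDual.toDual ∘ d) ?_
      Matrix.blockTriangular_one fun i j hij => ?_
    · intro i j hij
      have hij' : d i < d j := hij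
      rw [Matrix.sub_apply, hzero i j hij'.le,
        Matrix.one_apply_ne (by rintro rfl; exact lt_irrefl _ hij'), sub_zero]
    · rw [Matrix.sub_apply, hzero i j (le_of_eq (OrderDual.toDual_inj.mp hij)), sub_zero]
  have hdetN : (N - N'' * D).det = N.det := by
    have hzero : ∀ x y, d y ≤ d x → (N'' * D) x y = 0 := fun x y hxy => by
      rw [Matrix.mul_apply]
      refine sum_eq_zero fun z _ => ?_
      by_cases hxz : d x = d z
      · have : D z y = 0 := by
          by_contra h
          have := hD z y h
          omega
        rw [this, mul_zero]
      · rw [hN'', levelEval_apply_eq_zero hW _ hxz, zero_mul]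
    refine Matrix.BlockTriangular.det_eq_of_eq_on_blocks (b := d) ?_ ?_ fun i j hij => ?_
    · intro i j hij
      rw [Matrix.sub_apply, hzero i j hij.le, sub_zero]
      exact levelEval_apply_eq_zero hW _ hij.ne'
    · intro i j hij
      exact levelEval_apply_eq_zero hW _ hij.ne'
    · rw [Matrix.sub_apply, hzero i j hij.ge, sub_zero]
  have hne : N'.det ≠ 0 := by
    refine det_levelEval_ne_zero hU hD hc hw hwc m _ (fun j hj => ?_) fun j x hx => ?_
    · simp [levelShift, hm (j + 1) (by omega)]
    · rw [levelShift, eval_comp]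
      refine hp _ _ ?_
      simp only [eval_add, eval_X, eval_C]
      linarith [hwc j]
  have hdet := congrArg Matrix.det hfac
  rw [Matrix.det_mul, Matrix.det_mul, hdetU, mul_one, hdetN] at hdet
  have hprod := det_levelEval_mul_prod hU hD hc p fun j => (hp j 0 (hw j)).ne'
  refine mul_right_cancel₀ hne ?_
  rw [mul_right_comm, hdet, hprod]

end GradedDeterminant

section SubspaceCounting

theorem sub_one_mul_qInt (q m : ℕ) : ((q : ℚ) - 1) * qInt q m = (q : ℚ) ^ m - 1 := by
  rw [qInt, Nat.cast_sum, mul_comm]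
  simp only [Nat.cast_pow]
  exact geom_sum_mul _ _

variable {F : Type} [Field F]

/-- `Y` contains `X` with codimension one. -/
def IsCover {E : Type*} [AddCommGroup E] [Module F E] (X Y : Submodule F E) : Prop :=
  X ≤ Y ∧ Module.finrank F Y = Module.finrank F X + 1

variable {E : Type*} [AddCommGroup E] [Module F E]

open Classical in
/-- The matrix of the raising operator on the lattice of subspaces. -/
noncomputable def raising (F E : Type*) [Field F] [AddCommGroup E] [Module F E] :
    Matrix (Submodule F E) (Submodule F E) ℚ :=
  Matrix.of fun Y X => if X ≤ Y ∧ Module.finrank F Y = Module.finrank F X + 1 then 1 else 0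

theorem raising_apply_of_isCover {X Y : Submodule F E} (h : IsCover X Y) : raising F E Y X = 1 :=
  if_pos h

theorem raising_apply_of_not_isCover {X Y : Submodule F E} (h : ¬ IsCover X Y) :
    raising F E Y X = 0 :=
  if_neg h

theorem isCover_of_raising_apply_ne_zero {X Y : Submodule F E} (h : raising F E Y X ≠ 0) :
    IsCover X Y := by
  by_contra h'
  exact h (raising_apply_of_not_isCover h')

theorem raising_mul_self (X Y : Submodule F E) :
    raising F E Y X * raising F E Y X = raising F E Y X := by
  by_cases h : IsCover X Y
  · rw [raising_apply_of_isCover h, mul_one]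
  · rw [raising_apply_of_not_isCover h, mul_zero]

variable [FiniteDimensional F E]

theorem isCover_sup_span {X : Submodule F E} {v : E} (hv : v ∉ X) :
    IsCover X (X ⊔ Submodule.span F {v}) := by
  have hv0 : v ≠ 0 := by
    rintro rfl
    exact hv X.zero_mem
  refine ⟨le_sup_left, ?_⟩
  have h := Submodule.finrank_sup_add_finrank_inf_eq X (Submodule.span F {v})
  have hinf : X ⊓ Submodule.span F {v} = ⊥ := by
    rw [← disjoint_iff, Submodule.disjoint_span_singleton' hv0]
    exact hv
  rw [hinf, finrank_bot, finrank_span_singleton hv0] at h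
  omega

theorem sup_span_eq_of_isCover {X Y : Submodule F E} (h : IsCover X Y) {v : E} (hv : v ∉ X)
    (hvY : v ∈ Y) : X ⊔ Submodule.span F {v} = Y := by
  refine Submodule.eq_of_le_of_finrank_eq
    (sup_le h.1 ((Submodule.span_singleton_le_iff_mem v Y).mpr hvY)) ?_
  rw [(isCover_sup_span hv).2, h.2]

theorem natCard_isCover [Fintype F] (X : Submodule F E) :
    Nat.card {Y : Submodule F E // IsCover X Y}
      = qInt (Fintype.card F) (Module.finrank F E - Module.finrank F X) := by
  classical
  have : Finite E := Module.finite_of_finite F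
  have := Fintype.ofFinite E
  have := Fintype.ofFinite (Submodule F E)
  have hcardsub : ∀ Z : Submodule F E,
      (univ.filter fun v => v ∈ Z).card = Fintype.card F ^ Module.finrank F Z := by
    intro Z
    rw [← Module.card_eq_pow_finrank (K := F) (V := Z), ← Fintype.card_subtype]
  have hcount := card_eq_sum_card_fiberwise (s := univ.filter fun v => v ∉ X)
    (t := univ.filter fun Y => IsCover X Y) (f := fun v => X ⊔ Submodule.span F {v})
    (fun v hv => by simpa using isCover_sup_span (by simpa using hv))
  have hfiber : ∀ Y ∈ univ.filter (fun Y => IsCover X Y),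
      ((((univ.filter fun v => v ∉ X).filter fun v => X ⊔ Submodule.span F {v} = Y).card : ℕ) : ℚ)
        = (Fintype.card F : ℚ) ^ Module.finrank F X * (Fintype.card F - 1) := by
    intro Y hY
    have hY : IsCover X Y := by simpa using hY
    have hset : ((univ.filter fun v => v ∉ X).filter fun v => X ⊔ Submodule.span F {v} = Y)
        = (univ.filter fun v => v ∈ Y) \ (univ.filter fun v => v ∈ X) := by
      ext v
      simp only [mem_filter, mem_univ, true_and, mem_sdiff]
      constructor
      · rintro ⟨hv, rfl⟩
        exact ⟨Submodule.mem_sup_right (Submodule.mem_span_singleton_self v), hv⟩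
      · rintro ⟨hvY, hv⟩
        exact ⟨hv, sup_span_eq_of_isCover hY hv hvY⟩
    rw [hset, cast_card_sdiff (fun v hv => by simpa using hY.1 (by simpa using hv)), hcardsub,
      hcardsub, hY.2]
    push_cast
    ring
  have htotal : (((univ.filter fun v => v ∉ X).card : ℕ) : ℚ)
      = (Fintype.card F : ℚ) ^ Module.finrank F E - (Fintype.card F : ℚ) ^ Module.finrank F X := by
    have h := card_filter_add_card_filter_not (s := (univ : Finset E)) (fun v => v ∈ X)
    rw [hcardsub, card_univ, Module.card_eq_pow_finrank (K := F) (V := E)] at h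
    have h' : ((Fintype.card F : ℚ)) ^ Module.finrank F X + ((univ.filter fun v => v ∉ X).card : ℕ)
        = (Fintype.card F : ℚ) ^ Module.finrank F E := by exact_mod_cast h
    linarith
  have hcount' : (((univ.filter fun v => v ∉ X).card : ℕ) : ℚ)
      = ((univ.filter fun Y => IsCover X Y).card : ℕ) *
        ((Fintype.card F : ℚ) ^ Module.finrank F X * (Fintype.card F - 1)) := by
    rw [hcount, Nat.cast_sum, sum_congr rfl hfiber, sum_const, nsmul_eq_mul]
  have hle := Submodule.finrank_le X
  have hq : (1 : ℚ) < Fintype.card F := by exact_mod_cast Fintype.one_lt_card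
  rw [Nat.card_eq_fintype_card, Fintype.card_subtype]
  have hne : (Fintype.card F : ℚ) ^ Module.finrank F X * (Fintype.card F - 1) ≠ 0 :=
    mul_ne_zero (pow_ne_zero _ (by linarith)) (by linarith)
  have hgoal : (((univ.filter fun Y => IsCover X Y).card : ℕ) : ℚ)
      = qInt (Fintype.card F) (Module.finrank F E - Module.finrank F X) := by
    refine mul_right_cancel₀ hne ?_
    rw [← hcount', htotal]
    have h1 := sub_one_mul_qInt (Fintype.card F) (Module.finrank F E - Module.finrank F X)
    have h2 : (Fintype.card F : ℚ) ^ Module.finrank F E = (Fintype.card F : ℚ) ^ Module.finrank F X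
        * (Fintype.card F : ℚ) ^ (Module.finrank F E - Module.finrank F X) := by
      rw [← pow_add, Nat.add_sub_cancel' hle]
    rw [h2]
    linear_combination -(Fintype.card F : ℚ) ^ Module.finrank F X * h1
  exact_mod_cast hgoal

theorem isCover_iff_dualAnnihilator (X Y : Submodule F E) :
    IsCover Y X ↔ IsCover X.dualAnnihilator Y.dualAnnihilator := by
  have hX := Subspace.finrank_add_finrank_dualAnnihilator_eq X
  have hY := Subspace.finrank_add_finrank_dualAnnihilator_eq Y
  have hle : X.dualAnnihilator ≤ Y.dualAnnihilator ↔ Y ≤ X :=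
    Subspace.dualAnnihilator_le_dualAnnihilator_iff
  unfold IsCover
  rw [hle]
  refine and_congr_right fun _ => ?_
  omega

theorem natCard_isCover_below [Fintype F] (X : Submodule F E) :
    Nat.card {Y : Submodule F E // IsCover Y X}
      = qInt (Fintype.card F) (Module.finrank F X) := by
  have hcongr : Nat.card {Y : Submodule F E // IsCover Y X}
      = Nat.card {Y : Submodule F (Module.Dual F E) // IsCover X.dualAnnihilator Y} :=
    Nat.card_congr (Equiv.subtypeEquiv
      ((Subspace.orderIsoFiniteDimensional (K := F) (V := E)).toEquiv.trans OrderDual.ofDual)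
      fun Y => isCover_iff_dualAnnihilator X Y)
  have hX := Subspace.finrank_add_finrank_dualAnnihilator_eq X
  rw [hcongr, natCard_isCover, Subspace.dual_finrank_eq]
  congr 1
  omega

theorem eq_sup_of_isCover {X Z Y : Submodule F E} (hne : X ≠ Z) (hX : IsCover X Y)
    (hZ : IsCover Z Y) : Y = X ⊔ Z := by
  have hXZ : Module.finrank F X = Module.finrank F Z := by have := hX.2; have := hZ.2; omega
  have hlt : X < X ⊔ Z := lt_of_le_of_ne le_sup_left fun h =>
    hne (Submodule.eq_of_le_of_finrank_eq (sup_eq_left.mp h.symm) hXZ.symm).symm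
  refine (Submodule.eq_of_le_of_finrank_le (sup_le hX.1 hZ.1) ?_).symm
  have := Submodule.finrank_lt_finrank_of_lt hlt
  have := hX.2
  omega

theorem eq_inf_of_isCover {X Z Y : Submodule F E} (hne : X ≠ Z) (hX : IsCover Y X)
    (hZ : IsCover Y Z) : Y = X ⊓ Z := by
  have hXZ : Module.finrank F X = Module.finrank F Z := by have := hX.2; have := hZ.2; omega
  have hlt : X ⊓ Z < X := lt_of_le_of_ne inf_le_left fun h =>
    hne (Submodule.eq_of_le_of_finrank_eq (inf_eq_left.mp h) hXZ)
  refine Submodule.eq_of_le_of_finrank_le (le_inf hX.1 hZ.1) ?_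
  have := Submodule.finrank_lt_finrank_of_lt hlt
  have := hX.2
  omega

theorem isCover_sup_iff_isCover_inf (X Z : Submodule F E) :
    (IsCover X (X ⊔ Z) ∧ IsCover Z (X ⊔ Z)) ↔ (IsCover (X ⊓ Z) X ∧ IsCover (X ⊓ Z) Z) := by
  have h := Submodule.finrank_sup_add_finrank_inf_eq X Z
  simp only [IsCover, le_sup_left, le_sup_right, inf_le_left, inf_le_right, true_and]
  omega

theorem sum_raising_above [Fintype F] [Fintype (Submodule F E)] (X : Submodule F E) :
    ∑ Y, raising F E Y X = qInt (Fintype.card F) (Module.finrank F E - Module.finrank F X) := by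
  classical
  rw [← natCard_isCover X, Nat.card_eq_fintype_card, Fintype.card_subtype, card_filter,
    Nat.cast_sum]
  refine sum_congr rfl fun Y _ => ?_
  split_ifs with h
  · rw [raising_apply_of_isCover h, Nat.cast_one]
  · rw [raising_apply_of_not_isCover h, Nat.cast_zero]

theorem sum_raising_below [Fintype F] [Fintype (Submodule F E)] (X : Submodule F E) :
    ∑ Y, raising F E X Y = qInt (Fintype.card F) (Module.finrank F X) := by
  classical
  rw [← natCard_isCover_below X, Nat.card_eq_fintype_card, Fintype.card_subtype, card_filter,
    Nat.cast_sum]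
  refine sum_congr rfl fun Y _ => ?_
  split_ifs with h
  · rw [raising_apply_of_isCover h, Nat.cast_one]
  · rw [raising_apply_of_not_isCover h, Nat.cast_zero]

theorem raising_commutation [Fintype F] [Fintype (Submodule F E)] [DecidableEq (Submodule F E)] :
    (raising F E).transpose * raising F E = raising F E * (raising F E).transpose +
      Matrix.diagonal fun X : Submodule F E =>
        (qInt (Fintype.card F) (Module.finrank F E - Module.finrank F X) : ℚ)
          - qInt (Fintype.card F) (Module.finrank F X) := by
  ext X Z
  rw [Matrix.add_apply, Matrix.mul_apply, Matrix.mul_apply]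
  simp only [Matrix.transpose_apply]
  by_cases hXZ : X = Z
  · subst hXZ
    simp only [raising_mul_self, sum_raising_above, sum_raising_below, Matrix.diagonal_apply_eq]
    ring
  · rw [Matrix.diagonal_apply_ne _ hXZ, add_zero, sum_eq_single (X ⊔ Z), sum_eq_single (X ⊓ Z)]
    · have hiff := isCover_sup_iff_isCover_inf X Z
      by_cases h : IsCover X (X ⊔ Z) ∧ IsCover Z (X ⊔ Z)
      · have h' := hiff.mp h
        rw [raising_apply_of_isCover h.1, raising_apply_of_isCover h.2,
          raising_apply_of_isCover h'.1, raising_apply_of_isCover h'.2]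
      · have h' := mt hiff.mpr h
        trans (0 : ℚ)
        · rcases not_and_or.mp h with h | h
          · rw [raising_apply_of_not_isCover h, zero_mul]
          · rw [raising_apply_of_not_isCover h, mul_zero]
        · rcases not_and_or.mp h' with h | h
          · rw [raising_apply_of_not_isCover h, zero_mul]
          · rw [raising_apply_of_not_isCover h, mul_zero]
    · intro Y _ hY
      by_contra h
      exact hY (eq_inf_of_isCover hXZ (isCover_of_raising_apply_ne_zero (left_ne_zero_of_mul h))
        (isCover_of_raising_apply_ne_zero (right_ne_zero_of_mul h)))
    · exact fun h => absurd (mem_univ _) h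
    · intro Y _ hY
      by_contra h
      exact hY (eq_sup_of_isCover hXZ (isCover_of_raising_apply_ne_zero (left_ne_zero_of_mul h))
        (isCover_of_raising_apply_ne_zero (right_ne_zero_of_mul h)))
    · exact fun h => absurd (mem_univ _) h

end SubspaceCounting

section LevelPolynomials

theorem qInt_zero (q : ℕ) : qInt q 0 = 0 := rfl

theorem qInt_one (q : ℕ) : qInt q 1 = 1 := by simp [qInt]

theorem qInt_pos (q : ℕ) {m : ℕ} (hm : 1 ≤ m) : 0 < qInt q m := by
  obtain ⟨m, rfl⟩ := Nat.exists_eq_add_of_le' hm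
  rw [qInt, sum_range_succ', pow_zero]
  omega

theorem qInt_add (q k m : ℕ) : qInt q (k + m) = qInt q k + q ^ k * qInt q m := by
  simp only [qInt, sum_range_add, mul_sum, pow_add]

theorem qInt_mono (q : ℕ) : Monotone (qInt q) := fun a b h => by
  obtain ⟨m, rfl⟩ := Nat.exists_eq_add_of_le h
  rw [qInt_add]
  omega

theorem qInt_mul_succ (q s t : ℕ) :
    (qInt q s * qInt q (t + 1) + (qInt q t - qInt q s) : ℚ) = qInt q (s + 1) * qInt q t := by
  rw [add_comm t, add_comm s, qInt_add, qInt_add, qInt_one]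
  push_cast
  ring

variable (q n : ℕ)

/-- The difference of the numbers of upper and lower covers of a `j`-dimensional subspace. -/
def levelGap (j : ℕ) : ℚ := qInt q (n - j) - qInt q j

/-- The largest eigenvalue of lowering followed by raising on `j`-dimensional subspaces. -/
def levelWeight (j : ℕ) : ℚ := qInt q j * qInt q (n + 1 - j)

/-- The diagonal entries of the Laplacian of the cube, increased by one at the bottom. -/
def levelDiag (j : ℕ) : ℚ := qInt q j + qInt q (n - j) + if j = 0 then 1 else 0

/-- `levelContAux q n e` is the pivot polynomial at level `n + 1 - e`. -/
noncomputable def levelContAux : ℕ → ℚ[X]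
  | 0 => 1
  | 1 => C (levelDiag q n n) - (X + C (levelGap q n n))
  | e + 2 =>
      C (levelDiag q n (n - 1 - e)) *
          (levelContAux (e + 1)).comp (X + C (levelGap q n (n - 1 - e))) -
        ((levelContAux e).comp (X + C (levelGap q n (n - 1 - e + 1)))).comp
          (X + C (levelGap q n (n - 1 - e))) * (X + C (levelGap q n (n - 1 - e)))

/-- The continuant describing the elimination of all levels from `j` upwards. -/
noncomputable def levelCont (j : ℕ) : ℚ[X] := levelContAux q n (n + 1 - j)

variable {q n}

theorem levelCont_of_lt {j : ℕ} (h : n + 1 ≤ j) : levelCont q n j = 1 := by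
  rw [levelCont, Nat.sub_eq_zero_of_le h, levelContAux]

theorem levelCont_eq {j : ℕ} (h : j ≤ n) :
    levelCont q n j = C (levelDiag q n j) * levelShift (levelGap q n) (levelCont q n) j
      - levelShift (levelGap q n) (levelShift (levelGap q n) (levelCont q n)) j
        * (X + C (levelGap q n j)) := by
  simp only [levelShift]
  rcases h.eq_or_lt with rfl | h
  · rw [levelCont_of_lt (n := j) (j := j + 1) (by omega),
      levelCont_of_lt (n := j) (j := j + 1 + 1) (by omega), levelCont,
      show j + 1 - j = 1 by omega, levelContAux]
    simp
  · obtain ⟨e, rfl⟩ := Nat.exists_eq_add_of_lt h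
    rw [levelCont, levelCont, levelCont, show j + e + 1 + 1 - j = e + 2 by omega,
      show j + e + 1 + 1 - (j + 1) = e + 1 by omega,
      show j + e + 1 + 1 - (j + 1 + 1) = e by omega, levelContAux,
      show j + e + 1 - 1 - e = j by omega]

theorem eval_levelCont {j : ℕ} (h : j ≤ n) (x : ℚ) :
    (levelCont q n j).eval x
      = levelDiag q n j * (levelCont q n (j + 1)).eval (x + levelGap q n j)
        - (levelCont q n (j + 2)).eval (x + levelGap q n j + levelGap q n (j + 1))
          * (x + levelGap q n j) := by
  rw [levelCont_eq h]
  simp [levelShift]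

theorem levelWeight_nonneg (j : ℕ) : 0 ≤ levelWeight q n j := by
  unfold levelWeight
  positivity

theorem levelWeight_succ {j : ℕ} (h : j ≤ n) :
    levelWeight q n j + levelGap q n j = levelWeight q n (j + 1) := by
  obtain ⟨m, rfl⟩ := Nat.exists_eq_add_of_le h
  rw [levelWeight, levelWeight, levelGap, show j + m + 1 - j = m + 1 by omega,
    show j + m - j = m by omega, show j + m + 1 - (j + 1) = m by omega]
  exact qInt_mul_succ q j m

theorem levelWeight_add_levelGap_le (j : ℕ) :
    levelWeight q n j + levelGap q n j ≤ levelWeight q n (j + 1) := by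
  rcases le_or_gt j n with h | h
  · exact (levelWeight_succ h).le
  · rw [levelWeight, levelWeight, levelGap, show n + 1 - j = 0 by omega,
      show n - j = 0 by omega, show n + 1 - (j + 1) = 0 by omega, qInt_zero]
    simp

theorem levelCont_eval_pos_and_le (m j : ℕ) (hm : n + 1 ≤ j + m) (x : ℚ)
    (hx : x ≤ levelWeight q n j) :
    0 < (levelCont q n j).eval x ∧ (j ≤ n →
      qInt q j * (levelCont q n (j + 1)).eval (x + levelGap q n j)
        ≤ (levelCont q n j).eval x) := by
  induction m generalizing j x with
  | zero =>
    rw [levelCont_of_lt (by omega)]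
    exact ⟨by simp, fun h => by omega⟩
  | succ m ih =>
    rcases Nat.lt_or_ge n j with h | h
    · exact ih j (by omega) x hx
    · have hy : x + levelGap q n j ≤ levelWeight q n (j + 1) := by
        rw [← levelWeight_succ h]
        linarith
      obtain ⟨hpos, hle⟩ := ih (j + 1) (by omega) _ hy
      have hpos' := (ih (j + 2) (by omega) (x + levelGap q n j + levelGap q n (j + 1))
        (by linarith [levelWeight_add_levelGap_le (q := q) (n := n) (j + 1)])).1
      rw [eval_levelCont h]
      set y := x + levelGap q n j
      set A := (levelCont q n (j + 1)).eval y
      set B := (levelCont q n (j + 2)).eval (y + levelGap q n (j + 1))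
      have hAB : B * y ≤ qInt q (n - j) * A := by
        have hBy : B * y ≤ B * levelWeight q n (j + 1) := mul_le_mul_of_nonneg_left hy hpos'.le
        rw [levelWeight, show n + 1 - (j + 1) = n - j by omega] at hBy
        rcases h.eq_or_lt with rfl | h
        · rw [Nat.sub_self, qInt_zero] at hBy ⊢
          simpa using hBy
        · have h' := mul_le_mul_of_nonneg_left (hle h) (Nat.cast_nonneg' (α := ℚ) (qInt q (n - j)))
          linarith
      rw [levelDiag]
      rcases Nat.eq_zero_or_pos j with rfl | hj
      · rw [if_pos rfl, qInt_zero]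
        push_cast
        exact ⟨by linarith, fun _ => by linarith⟩
      · rw [if_neg hj.ne']
        have hQ : (0 : ℚ) < qInt q j * A := mul_pos (by exact_mod_cast qInt_pos q hj) hpos
        exact ⟨by linarith, fun _ => by linarith⟩

theorem levelCont_eval_pos (j : ℕ) (x : ℚ) (hx : x ≤ levelWeight q n j) :
    0 < (levelCont q n j).eval x :=
  (levelCont_eval_pos_and_le (n + 1) j (by omega) x hx).1

theorem eval_levelCont_levelWeight (m j : ℕ) (hj : 1 ≤ j) (hjn : j ≤ n + 1) (hm : n + 1 ≤ j + m) :
    (levelCont q n j).eval (levelWeight q n j) = ∏ i ∈ Ico j (n + 1), (qInt q i : ℚ) := by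
  induction m generalizing j with
  | zero =>
    obtain rfl : j = n + 1 := by omega
    simp [levelCont_of_lt le_rfl]
  | succ m ih =>
    rcases hjn.eq_or_lt with rfl | hjn
    · simp [levelCont_of_lt le_rfl]
    have h : j ≤ n := by omega
    rw [eval_levelCont h, levelWeight_succ h, ih (j + 1) (by omega) (by omega) (by omega),
      prod_eq_prod_Ico_succ_bot hjn, levelDiag, if_neg (by omega)]
    rcases h.eq_or_lt with rfl | h
    · simp [levelWeight, qInt_zero]
    · rw [levelWeight_succ h, ih (j + 2) (by omega) (by omega) (by omega),
        prod_eq_prod_Ico_succ_bot (show j + 1 < n + 1 by omega), levelWeight,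
        show n + 1 - (j + 1) = n - j by omega]
      ring

theorem eval_levelCont_zero (hn : 1 ≤ n) :
    (levelCont q n 0).eval 0 = ∏ i ∈ Icc 1 n, (qInt q i : ℚ) := by
  have h0 : levelWeight q n 0 = 0 := by simp [levelWeight, qInt_zero]
  rw [eval_levelCont (Nat.zero_le n), ← h0, levelWeight_succ (Nat.zero_le n),
    levelWeight_succ (by omega), eval_levelCont_levelWeight n (0 + 1) le_rfl (by omega) (by omega),
    eval_levelCont_levelWeight n (0 + 2) (by omega) (by omega) (by omega),
    show Icc 1 n = Ico 1 (n + 1) from rfl, prod_eq_prod_Ico_succ_bot (show 0 + 1 < n + 1 by omega),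
    levelDiag, levelWeight, if_pos rfl, qInt_zero, qInt_one,
    show n + 1 - (0 + 1) = n by omega, Nat.sub_zero]
  simp only [zero_add, Nat.reduceAdd, Nat.cast_zero, Nat.cast_one]
  ring

theorem cast_eval_geom_sum (q m : ℕ) :
    (((∑ i ∈ range m, (X : ℤ[X]) ^ i).eval (q : ℤ) : ℤ) : ℚ) = qInt q m := by
  simp [eval_finsetSum, qInt]

theorem primitiveWeight_succ {k i : ℕ} (hk : k ≤ i) (hi : i ≤ n - k) (hkn : 2 * k ≤ n) :
    (q : ℚ) ^ k * qInt q (i - k) * qInt q (n - k + 1 - i) + levelGap q n i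
      = (q : ℚ) ^ k * qInt q (i + 1 - k) * qInt q (n - k - i) := by
  obtain ⟨s, rfl⟩ := Nat.exists_eq_add_of_le hk
  obtain ⟨t, ht⟩ := Nat.exists_eq_add_of_le hi
  obtain rfl : n = k + s + t + k := by omega
  rw [levelGap, show k + s - k = s by omega, show k + s + t + k - k + 1 - (k + s) = t + 1 by omega,
    show k + s + t + k - (k + s) = k + t by omega, show k + s + 1 - k = s + 1 by omega,
    show k + s + t + k - k - (k + s) = t by omega, qInt_add q k t, qInt_add q k s]
  push_cast
  linear_combination (q : ℚ) ^ k * qInt_mul_succ q s t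

theorem Faux_eval_mul {k : ℕ} (hk : 1 ≤ k) (hkn : 2 * k ≤ n) (e : ℕ) (he : e ≤ n - 2 * k + 1) :
    (((Faux n k e).eval (q : ℤ) : ℤ) : ℚ) * (levelCont q n (n - k + 1)).eval 0
      = (levelCont q n (n - k + 1 - e)).eval
        ((q : ℚ) ^ k * qInt q (n - k + 1 - e - k) * qInt q (n - k + 1 - (n - k + 1 - e))) := by
  induction e using Nat.twoStepInduction with
  | zero => simp [Faux, qInt_zero]
  | one =>
    rw [Faux, eval_add, Int.cast_add, cast_eval_geom_sum, cast_eval_geom_sum,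
      show n - k + 1 - 1 = n - k by omega, eval_levelCont (j := n - k) (by omega),
      primitiveWeight_succ (by omega) le_rfl hkn, Nat.sub_self, qInt_zero, levelDiag,
      if_neg (by omega), show n - (n - k) = k by omega]
    simp only [Nat.cast_zero, mul_zero]
    ring
  | more e ih ih' =>
    obtain ⟨j, hj⟩ : ∃ j, j = n - k - 1 - e := ⟨_, rfl⟩
    have ih := ih (by omega)
    have ih' := ih' (by omega)
    rw [show n - k + 1 - e = j + 2 by omega] at ih
    rw [show n - k + 1 - (e + 1) = j + 1 by omega] at ih'
    rw [show n - k + 1 - (e + 2) = j by omega, eval_levelCont (j := j) (by omega),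
      primitiveWeight_succ (i := j) (by omega) (by omega) hkn]
    have h1 := primitiveWeight_succ (q := q) (i := j + 1) (by omega : k ≤ j + 1) (by omega) hkn
    rw [show n - k + 1 - (j + 1) = n - k - j by omega] at h1 ih'
    rw [show n - k + 1 - (j + 2) = n - k - (j + 1) by omega] at ih
    rw [h1, Faux, ← hj, ← ih', ← ih, levelDiag, if_neg (by omega)]
    simp only [eval_sub, eval_mul, eval_add, Int.cast_sub, Int.cast_mul, Int.cast_add,
      cast_eval_geom_sum, eval_pow, eval_X, Int.cast_pow, Int.cast_natCast]
    ring

theorem FP_eval_mul {k : ℕ} (hk : 1 ≤ k) (hkn : 2 * k ≤ n) :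
    (((FP n k k).eval (q : ℤ) : ℤ) : ℚ) * (levelCont q n (n - k + 1)).eval 0
      = (levelCont q n k).eval 0 := by
  rw [FP, Faux_eval_mul hk hkn _ (by omega), show n - k + 1 - (n - k + 1 - k) = k by omega,
    Nat.sub_self, qInt_zero]
  simp

end LevelPolynomials

section Assembly

theorem prod_range_eq_prod_pairs {M : Type*} [CommMonoid M] (n : ℕ) (h : ℕ → M)
    (hmid : ∀ j, 2 * j + 1 = n → h j = 1) :
    ∏ j ∈ range n, h j = ∏ k ∈ range (n / 2), h k * h (n - 1 - k) := by
  induction n using Nat.twoStepInduction generalizing h with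
  | zero => simp
  | one => simpa using hmid 0 rfl
  | more n ih _ =>
    have hk : ∀ k ∈ range (n / 2), h (k + 1) * h (n + 2 - 1 - (k + 1))
        = h (k + 1) * h (n - 1 - k + 1) := by
      intro k hk
      rw [show n + 2 - 1 - (k + 1) = n - 1 - k + 1 by have := mem_range.mp hk; omega]
    rw [prod_range_succ, prod_range_succ', ih (fun j => h (j + 1)) fun j hj => hmid _ (by omega),
      show (n + 2) / 2 = n / 2 + 1 by omega, prod_range_succ' _ (n / 2), prod_congr rfl hk,
      show n + 2 - 1 - 0 = n + 1 by omega, mul_assoc]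

theorem prod_pow_eq_prod_pow_sub_mul {n : ℕ} {T φ : ℕ → ℚ} {g : ℕ → ℕ} (hT : ∀ j, T j ≠ 0)
    (hφ : ∀ k, 1 ≤ k → 2 * k ≤ n → φ k * T (n - k + 1) = T k)
    (hg : ∀ k, k ≤ n → g (n - k) = g k) (hmono : ∀ k, 1 ≤ k → 2 * k ≤ n → g (k - 1) ≤ g k) :
    ∏ j ∈ range n, T (j + 1) ^ g (j + 1)
      = (∏ k ∈ Icc 1 (n / 2), φ k ^ (g k - g (k - 1))) * ∏ j ∈ range n, T (j + 1) ^ g j := by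
  have hpair := prod_range_eq_prod_pairs n (fun j => T (j + 1) ^ ((g (j + 1) : ℤ) - g j))
    fun j hj => by
      have := hg j (by omega)
      rw [show n - j = j + 1 by omega] at this
      rw [this, sub_self, zpow_zero]
  have hIcc : ∏ k ∈ Icc 1 (n / 2), φ k ^ (g k - g (k - 1))
      = ∏ k ∈ range (n / 2), φ (k + 1) ^ (g (k + 1) - g k) := by
    rw [range_eq_Ico]
    exact (prod_Ico_add' (fun k => φ k ^ (g k - g (k - 1))) 0 (n / 2) 1).symm
  have hterm : ∀ k ∈ range (n / 2), φ (k + 1) ^ (g (k + 1) - g k)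
      = T (k + 1) ^ ((g (k + 1) : ℤ) - g k)
        * T (n - 1 - k + 1) ^ ((g (n - 1 - k + 1) : ℤ) - g (n - 1 - k)) := by
    intro k hk
    have hk := mem_range.mp hk
    have h1 := hg k (by omega)
    have h2 := hg (k + 1) (by omega)
    have h3 := hφ (k + 1) (by omega) (by omega)
    have h4 : g k ≤ g (k + 1) := hmono (k + 1) (by omega) (by omega)
    rw [show n - (k + 1) + 1 = n - 1 - k + 1 by omega] at h3
    rw [show n - k = n - 1 - k + 1 by omega] at h1
    rw [show n - (k + 1) = n - 1 - k by omega] at h2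
    rw [h1, h2, ← neg_sub (g (k + 1) : ℤ) (g k), zpow_neg, ← div_eq_mul_inv, ← div_zpow,
      ← h3, mul_div_cancel_right₀ _ (hT _), ← Nat.cast_sub h4, zpow_natCast]
  rw [hIcc, prod_congr rfl hterm, ← hpair, ← prod_mul_distrib]
  refine prod_congr rfl fun j _ => ?_
  rw [zpow_sub₀ (hT _), zpow_natCast, zpow_natCast, div_mul_cancel₀ _ (pow_ne_zero _ (hT _))]

variable {F : Type} [Field F]

theorem gauss_zero (n : ℕ) : gauss F n 0 = 1 := by
  have : Unique {X : Submodule F (Fin n → F) // Module.finrank F X = 0} :=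
    { default := ⟨⊥, finrank_bot F _⟩
      uniq := fun X => Subtype.ext (Submodule.finrank_eq_zero.mp X.2) }
  exact Nat.card_unique

theorem gauss_self (n : ℕ) : gauss F n n = 1 := by
  have : Unique {X : Submodule F (Fin n → F) // Module.finrank F X = n} :=
    { default := ⟨⊤, by rw [finrank_top, Module.finrank_fin_fun]⟩
      uniq := fun X => Subtype.ext
        (Submodule.eq_top_of_finrank_eq (by rw [X.2, Module.finrank_fin_fun])) }
  exact Nat.card_unique

theorem prod_finrank_eq_prod_pow_gauss (n : ℕ) [Fintype (Submodule F (Fin n → F))] (f : ℕ → ℚ) :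
    ∏ X : Submodule F (Fin n → F), f (Module.finrank F X)
      = ∏ j ∈ range (n + 1), f j ^ gauss F n j := by
  classical
  rw [← prod_fiberwise_of_maps_to (s := univ) (t := range (n + 1))
    (g := fun X : Submodule F (Fin n → F) => Module.finrank F X) fun X _ => by
      have := Submodule.finrank_le X
      rw [Module.finrank_fin_fun] at this
      exact mem_range.mpr (by omega)]
  refine prod_congr rfl fun j _ => ?_
  rw [prod_congr rfl fun X hX => by rw [(mem_filter.mp hX).2], prod_const, gauss,
    Nat.card_eq_fintype_card, Fintype.card_subtype]

variable [Fintype F]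

theorem gauss_mul_qInt (n j : ℕ) :
    gauss F n j * qInt (Fintype.card F) (n - j)
      = gauss F n (j + 1) * qInt (Fintype.card F) (j + 1) := by
  classical
  have := Fintype.ofFinite (Submodule F (Fin n → F))
  have hgauss : ∀ k m : ℕ, ((gauss F n k * m : ℕ) : ℚ)
      = ∑ X : Submodule F (Fin n → F), if Module.finrank F X = k then (m : ℚ) else 0 := by
    intro k m
    rw [gauss, Nat.card_eq_fintype_card, Fintype.card_subtype, ← sum_filter, sum_const,
      nsmul_eq_mul, Nat.cast_mul]
  have hleft : ∀ X : Submodule F (Fin n → F),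
      (if Module.finrank F X = j then (qInt (Fintype.card F) (n - j) : ℚ) else 0)
        = ∑ Y, if Module.finrank F X = j then raising F (Fin n → F) Y X else 0 := by
    intro X
    split_ifs with h
    · rw [sum_raising_above, Module.finrank_fin_fun, h]
    · rw [sum_const_zero]
  have hright : ∀ Y : Submodule F (Fin n → F),
      (if Module.finrank F Y = j + 1 then (qInt (Fintype.card F) (j + 1) : ℚ) else 0)
        = ∑ X : Submodule F (Fin n → F), if Module.finrank F X = j then raising F (Fin n → F) Y X else 0 := by
    intro Y
    have hterm : ∀ X : Submodule F (Fin n → F),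
        (if Module.finrank F X = j then raising F (Fin n → F) Y X else 0)
          = if Module.finrank F Y = j + 1 then raising F (Fin n → F) Y X else 0 := by
      intro X
      by_cases hXY : IsCover X Y
      · simp only [hXY.2, Nat.add_right_cancel_iff]
      · simp only [raising_apply_of_not_isCover hXY, ite_self]
    rw [sum_congr rfl fun X _ => hterm X]
    split_ifs with h
    · rw [sum_raising_below, h]
    · rw [sum_const_zero]
  have hcast : ((gauss F n j * qInt (Fintype.card F) (n - j) : ℕ) : ℚ)
      = ((gauss F n (j + 1) * qInt (Fintype.card F) (j + 1) : ℕ) : ℚ) := by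
    rw [hgauss, hgauss, sum_congr rfl fun X _ => hleft X, sum_congr rfl fun Y _ => hright Y,
      sum_comm]
  exact_mod_cast hcast

theorem gauss_sub {n k : ℕ} (hk : k ≤ n) : gauss F n (n - k) = gauss F n k := by
  induction k with
  | zero => rw [Nat.sub_zero, gauss_self, gauss_zero]
  | succ k ih =>
    have h1 := gauss_mul_qInt (F := F) n k
    have h2 := gauss_mul_qInt (F := F) n (n - (k + 1))
    rw [show n - (n - (k + 1)) = k + 1 by omega, show n - (k + 1) + 1 = n - k by omega,
      ih (by omega), h1] at h2
    exact Nat.eq_of_mul_eq_mul_right (qInt_pos _ (by omega)) h2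

theorem gauss_pred_le {n k : ℕ} (hk : 1 ≤ k) (hkn : 2 * k ≤ n) :
    gauss F n (k - 1) ≤ gauss F n k := by
  have h := gauss_mul_qInt (F := F) n (k - 1)
  rw [Nat.sub_add_cancel hk] at h
  refine Nat.le_of_mul_le_mul_right ?_ (qInt_pos (Fintype.card F) hk)
  rw [← h]
  exact Nat.mul_le_mul_left _ (qInt_mono _ (by omega))

theorem lapMatrix_vsCube_add_single (n : ℕ) [Fintype (Submodule F (Fin n → F))]
    [DecidableEq (Submodule F (Fin n → F))] [DecidableRel (vsCube F n).Adj] :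
    (vsCube F n).lapMatrix ℚ + Matrix.single ⊥ ⊥ 1
      = Matrix.diagonal (fun X : Submodule F (Fin n → F) =>
          levelDiag (Fintype.card F) n (Module.finrank F X))
        - raising F (Fin n → F) - (raising F (Fin n → F)).transpose := by
  have hadj : (vsCube F n).adjMatrix ℚ
      = raising F (Fin n → F) + (raising F (Fin n → F)).transpose := by
    ext X Y
    have hiff : (vsCube F n).Adj X Y ↔ IsCover X Y ∨ IsCover Y X := by
      rw [vsCube, SimpleGraph.fromRel_adj]
      refine ⟨fun h => h.2, fun h => ⟨?_, h⟩⟩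
      rintro rfl
      rcases h with h | h <;> exact absurd h.2 (by omega)
    rw [SimpleGraph.adjMatrix_apply, Matrix.add_apply, Matrix.transpose_apply]
    by_cases h1 : IsCover X Y
    · have h2 : ¬ IsCover Y X := fun h2 => by have := h1.2; have := h2.2; omega
      rw [if_pos (hiff.mpr (Or.inl h1)), raising_apply_of_isCover h1,
        raising_apply_of_not_isCover h2, zero_add]
    · rw [raising_apply_of_not_isCover h1, add_zero]
      by_cases h2 : IsCover Y X
      · rw [if_pos (hiff.mpr (Or.inr h2)), raising_apply_of_isCover h2]
      · rw [if_neg (fun h => (hiff.mp h).elim h1 h2), raising_apply_of_not_isCover h2]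
  have hdeg : ∀ X, ((vsCube F n).degree X : ℚ) = qInt (Fintype.card F) (Module.finrank F X)
      + qInt (Fintype.card F) (n - Module.finrank F X) := by
    intro X
    have h := SimpleGraph.adjMatrix_mulVec_const_apply (α := ℚ) (G := vsCube F n) (a := 1) (v := X)
    rw [mul_one] at h
    rw [← h, hadj, Matrix.mulVec, dotProduct]
    simp only [Function.const_apply, mul_one, Matrix.add_apply, Matrix.transpose_apply,
      sum_add_distrib]
    rw [sum_raising_above, sum_raising_below, Module.finrank_fin_fun]
  have hdiag : (vsCube F n).degMatrix ℚ + Matrix.single ⊥ ⊥ 1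
      = Matrix.diagonal (fun X : Submodule F (Fin n → F) =>
          levelDiag (Fintype.card F) n (Module.finrank F X)) := by
    rw [← Matrix.diagonal_single, SimpleGraph.degMatrix, Matrix.diagonal_add]
    congr 1
    ext X
    rw [hdeg, levelDiag, Pi.single_apply]
    simp only [Submodule.finrank_eq_zero]
  rw [SimpleGraph.lapMatrix, hadj, ← hdiag]
  abel

end Assembly

theorem complexity_vsCube (q n : ℕ) (hq : IsPrimePow q) (hn : 1 ≤ n)
    (F : Type) [Field F] [Fintype F] (hF : Fintype.card F = q) :
    (complexity (vsCube F n) : ℤ) =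
      (∏ i ∈ Finset.Icc 1 n, (qInt q i : ℤ)) *
        ∏ k ∈ Finset.Icc 1 (n / 2),
          ((FP n k k).eval (q : ℤ)) ^ (gauss F n k - gauss F n (k - 1)) := by
  classical
  have := Fintype.ofFinite (Submodule F (Fin n → F))
  have hcomm := raising_commutation (F := F) (E := Fin n → F)
  simp only [Module.finrank_fin_fun, hF] at hcomm
  have hdet := complexity_eq_det (vsCube F n) ⊥
  rw [lapMatrix_vsCube_add_single, hF] at hdet
  set T : ℕ → ℚ := fun j => (levelCont q n j).eval 0 with hT
  have hTne : ∀ j, T j ≠ 0 := fun j => (levelCont_eval_pos j 0 (levelWeight_nonneg j)).ne'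
  have hfinrank : ∀ X : Submodule F (Fin n → F), Module.finrank F X ≤ n := fun X => by
    simpa using Submodule.finrank_le X
  have hprod := det_diagonal_sub_sub_mul_prod
    (U := raising F (Fin n → F)) (D := (raising F (Fin n → F)).transpose)
    (d := fun X : Submodule F (Fin n → F) => Module.finrank F X) (c := levelGap q n)
    (fun X Y h => (isCover_of_raising_apply_ne_zero h).2)
    (fun X Y h => (isCover_of_raising_apply_ne_zero h).2) hcomm levelWeight_nonneg
    levelWeight_add_levelGap_le (n + 1) (levelCont q n) (fun j h => levelCont_of_lt h)
    levelCont_eval_pos (levelDiag q n) (fun X => levelCont_eq (hfinrank X))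
  rw [← hdet, prod_finrank_eq_prod_pow_gauss n fun j => T (j + 1),
    prod_finrank_eq_prod_pow_gauss n T, prod_range_succ, prod_range_succ', gauss_zero, pow_one,
    show T (n + 1) = 1 by simp [hT, levelCont_of_lt], one_pow, mul_one,
    prod_pow_eq_prod_pow_sub_mul hTne (fun k hk hkn => FP_eval_mul hk hkn) (fun k => gauss_sub)
      (fun k => gauss_pred_le), mul_right_comm] at hprod
  have hcast := mul_right_cancel₀ (prod_ne_zero_iff.mpr fun j _ => pow_ne_zero _ (hTne _)) hprod
  rw [show T 0 = _ from eval_levelCont_zero hn, mul_comm] at hcast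
  exact_mod_cast hcast
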